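/- Let Π be a nonnegative function on the q×q real symmetric positive definite matrices such that Π(Σ) = π(log λ₁(Σ), …, log λ_q(Σ)) for a convex, permutation-invariant π : ℝ^q → ℝ (λ₁(Σ) ≥ ⋯ ≥ λ_q(Σ) the eigenvalues in decreasing order), and suppose Π(Σ*) = 0 for some positive definite Σ*. Let (S_n) be a sequence of positive definite matrices converging to a positive definite matrix Σ_o, and let (η_n) be a sequence with η_n ≥ 0 converging to some η° ≥ 0. Let Σ̂_n be the unique minimizer over positive definite Σ of L(Σ; S_n, η_n) = tr(Σ⁻¹S_n) + log det(Σ) + η_n·Π(Σ), and let Σ_{η°} be the unique minimizer of L(Σ; Σ_o, η°). Then Σ̂_n → Σ_{η°}. In particular, if η_n → 0 then Σ̂_n → Σ_o. -/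

import Mathlib

open Matrix

/-- The eigenvalues of a Hermitian real matrix, sorted in decreasing order. -/
noncomputable def eigsDesc {q : ℕ} (A : Matrix (Fin q) (Fin q) ℝ)
    (hA : A.IsHermitian) : Fin q → ℝ :=
  fun i => (hA.eigenvalues ∘ Tuple.sort hA.eigenvalues) i.rev

theorem aux_perm {q : ℕ} (f g : Fin q → ℝ)
    (h : Multiset.map f Finset.univ.val = Multiset.map g Finset.univ.val) :
    ∃ σ : Equiv.Perm (Fin q), f = g ∘ σ := by
  have h1 : f ∘ Tuple.sort f = g ∘ Tuple.sort g := by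
    apply List.ofFn_injective
    apply List.Perm.eq_of_pairwise (le := (· ≤ ·))
    · intro a b _ _ h1 h2; exact le_antisymm h1 h2
    · exact (Tuple.monotone_sort f).sortedLE_ofFn.pairwise
    · exact (Tuple.monotone_sort g).sortedLE_ofFn.pairwise
    · have h2 : (List.ofFn f).Perm (List.ofFn g) := by
        simpa using h
      exact ((Equiv.Perm.ofFn_comp_perm _ f).trans h2).trans (Equiv.Perm.ofFn_comp_perm _ g).symm
  refine ⟨(Tuple.sort f).symm.trans (Tuple.sort g), ?_⟩
  funext i
  have := congrFun h1 ((Tuple.sort f).symm i)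
  simpa using this

/-- orthogonal conjugate of `diag (exp y)` -/
noncomputable def cj {q : ℕ} (U : Matrix (Fin q) (Fin q) ℝ) (y : Fin q → ℝ) :
    Matrix (Fin q) (Fin q) ℝ :=
  U * diagonal (fun i => Real.exp (y i)) * Uᵀ

theorem cj_posDef {q : ℕ} (U : Matrix (Fin q) (Fin q) ℝ) (y : Fin q → ℝ) (hU : Uᵀ * U = 1) :
    (cj U y).PosDef := by
  have hU' : IsUnit U := IsUnit.of_mul_eq_one_right _ hU
  have := (Matrix.IsUnit.posDef_star_right_conjugate_iff
    (x := diagonal (fun i => Real.exp (y i))) hU').2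
    (PosDef.diagonal fun i => Real.exp_pos _)
  simpa [cj, star_eq_conjTranspose] using this

theorem cj_inv {q : ℕ} (U : Matrix (Fin q) (Fin q) ℝ) (y : Fin q → ℝ) (hU : Uᵀ * U = 1) :
    (cj U y)⁻¹ = cj U (-y) := by
  have hU' : U * Uᵀ = 1 := mul_eq_one_comm.1 hU
  apply Matrix.inv_eq_right_inv
  have : cj U y * cj U (-y) = U * (diagonal (fun i => Real.exp (y i)) * (Uᵀ * U) *
    diagonal (fun i => Real.exp ((-y) i))) * Uᵀ := by
    simp only [cj, Matrix.mul_assoc]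
  rw [this, hU, Matrix.mul_one, diagonal_mul_diagonal]
  simp [← Real.exp_add, hU']

theorem cj_trace {q : ℕ} (U : Matrix (Fin q) (Fin q) ℝ) (y : Fin q → ℝ) (hU : Uᵀ * U = 1)
    (S : Matrix (Fin q) (Fin q) ℝ) :
    ((cj U y)⁻¹ * S).trace = ∑ i, Real.exp (- y i) * (Uᵀ * S * U) i i := by
  rw [cj_inv U y hU, cj, Matrix.mul_assoc, Matrix.mul_assoc, Matrix.trace_mul_comm,
    Matrix.mul_assoc, ]
  simp [Matrix.trace, diagonal_mul]

theorem cj_logdet {q : ℕ} (U : Matrix (Fin q) (Fin q) ℝ) (y : Fin q → ℝ) (hU : Uᵀ * U = 1) :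
    Real.log (cj U y).det = ∑ i, y i := by
  have : (cj U y).det = Real.exp (∑ i, y i) := by
    rw [cj, Matrix.mul_assoc, Matrix.det_mul_comm, Matrix.mul_assoc, hU, Matrix.mul_one,
      det_diagonal, Real.exp_sum]
  rw [this, Real.log_exp]

theorem cj_pen {q : ℕ} (π : (Fin q → ℝ) → ℝ)
    (hπperm : ∀ (σ : Equiv.Perm (Fin q)) (y : Fin q → ℝ), π (y ∘ σ) = π y)
    (Pen : Matrix (Fin q) (Fin q) ℝ → ℝ)
    (hPen : ∀ (A : Matrix (Fin q) (Fin q) ℝ) (hA : A.PosDef),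
      Pen A = π fun i => Real.log (eigsDesc A hA.isHermitian i))
    (U : Matrix (Fin q) (Fin q) ℝ) (y : Fin q → ℝ) (hU : Uᵀ * U = 1) :
    Pen (cj U y) = π y := by
  have hA := cj_posDef U y hU
  rw [hPen _ hA]
  have h1 : (cj U y).charpoly.roots =
      Multiset.map (fun i => Real.exp (y i)) Finset.univ.val := by
    rw [cj, Matrix.mul_assoc, charpoly_mul_comm, Matrix.mul_assoc, hU, Matrix.mul_one,
      charpoly_diagonal, Polynomial.roots_prod]
    · simp
    · simp [Finset.prod_ne_zero_iff, Polynomial.X_sub_C_ne_zero]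
  have h2 := hA.isHermitian.roots_charpoly_eq_eigenvalues
  rw [h1] at h2
  obtain ⟨σ, hσ⟩ := aux_perm hA.isHermitian.eigenvalues (fun i => Real.exp (y i)) h2.symm
  have : (fun i => Real.log (eigsDesc (cj U y) hA.isHermitian i)) =
      y ∘ (Fin.revPerm.trans ((Tuple.sort hA.isHermitian.eigenvalues).trans σ)) := by
    funext i
    simp only [eigsDesc, Function.comp]
    rw [congrFun hσ]
    simp
  rw [this, hπperm]

theorem exists_cj {q : ℕ} (A : Matrix (Fin q) (Fin q) ℝ) (hA : A.PosDef) :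
    ∃ (U : Matrix (Fin q) (Fin q) ℝ) (y : Fin q → ℝ), Uᵀ * U = 1 ∧ A = cj U y := by
  refine ⟨hA.isHermitian.eigenvectorUnitary, fun i => Real.log (hA.isHermitian.eigenvalues i),
    ?_, ?_⟩
  · have := Unitary.coe_star_mul_self hA.isHermitian.eigenvectorUnitary
    simpa [star_eq_conjTranspose] using this
  · conv_lhs => rw [hA.isHermitian.spectral_theorem]
    have : (fun i => Real.exp (Real.log (hA.isHermitian.eigenvalues i))) =
      hA.isHermitian.eigenvalues := by
      funext i
      exact Real.exp_log (hA.eigenvalues_pos i)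
    simp only [cj, this, Unitary.conjStarAlgAut_apply, star_eq_conjTranspose]
    simp

theorem ortho_compact (q : ℕ) :
    IsCompact {U : Matrix (Fin q) (Fin q) ℝ | Uᵀ * U = 1} := by
  have hc : IsCompact (Set.univ.pi fun _ : Fin q => Set.univ.pi fun _ : Fin q =>
      Set.Icc (-1 : ℝ) 1) :=
    isCompact_univ_pi fun _ => isCompact_univ_pi fun _ => isCompact_Icc
  refine IsCompact.of_isClosed_subset hc ?_ ?_
  · exact isClosed_eq (by fun_prop) continuous_const
  · intro U hU
    intro i _ j _
    have : U ∈ Matrix.unitaryGroup (Fin q) ℝ := by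
      rw [Matrix.mem_unitaryGroup_iff']
      simpa [star_eq_conjTranspose] using hU
    have h := entry_norm_bound_of_unitary this i j
    rw [Real.norm_eq_abs, abs_le] at h
    exact h

theorem gauss_ineq {q : ℕ} (A S : Matrix (Fin q) (Fin q) ℝ) (hA : A.PosDef) (hS : S.PosDef) :
    (q : ℝ) + Real.log S.det ≤ (A⁻¹ * S).trace + Real.log A.det := by
  obtain ⟨U, y, hU, hSU⟩ := exists_cj S hS
  obtain ⟨V, z, hV, hAV⟩ := exists_cj A hA
  let W := V * diagonal (fun i => Real.exp (- z i / 2))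
  have hW : W * Wᵀ = A⁻¹ := by
    rw [hAV, cj_inv V z hV, cj]
    have : W * Wᵀ = V * (diagonal (fun i => Real.exp (- z i / 2)) *
      diagonal (fun i => Real.exp (- z i / 2))) * Vᵀ := by
      simp only [W, Matrix.mul_assoc, Matrix.transpose_mul, diagonal_transpose]
    rw [this, diagonal_mul_diagonal]
    simp [← Real.exp_add]
  have hdW : W.det * W.det * A.det = 1 := by
    have h := congrArg det hW
    rw [det_mul, det_transpose] at h
    rw [h, det_nonsing_inv, Ring.inverse_eq_inv', inv_mul_cancel₀ hA.det_pos.ne']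
  have hWu : W.det ≠ 0 := by
    intro h; simp [h] at hdW
  have hM : (Wᵀ * S * W).PosDef := by
    have := (Matrix.IsUnit.posDef_star_left_conjugate_iff (x := S) (U := W)
      ((Matrix.isUnit_iff_isUnit_det W).2 hWu.isUnit)).2 hS
    simpa [star_eq_conjTranspose] using this
  obtain ⟨R, x, hR, hRx⟩ := exists_cj _ hM
  have htr : (A⁻¹ * S).trace = ∑ i, Real.exp (x i) := by
    rw [← hW, Matrix.mul_assoc, Matrix.trace_mul_comm, hRx, cj, Matrix.mul_assoc,
      Matrix.trace_mul_comm, Matrix.mul_assoc, hR, Matrix.mul_one, trace_diagonal]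
  have hdet : Real.log S.det - Real.log A.det = ∑ i, x i := by
    rw [← cj_logdet R x hR, ← hRx, det_mul, det_mul, det_transpose,
      ← Real.log_div hS.det_pos.ne' hA.det_pos.ne']
    congr 1
    rw [div_eq_iff hA.det_pos.ne']
    linear_combination (-S.det) * hdW
  have : ∑ i : Fin q, (x i + 1) ≤ ∑ i, Real.exp (x i) :=
    Finset.sum_le_sum fun i _ => Real.add_one_le_exp _
  rw [Finset.sum_add_distrib] at this
  simp at this
  linarith

theorem y_bound {q : ℕ} (c C : ℝ) (hc : 0 < c) (y m : Fin q → ℝ) (hm : ∀ i, c ≤ m i)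
    (h : ∑ i, Real.exp (- y i) * m i + ∑ i, y i ≤ C) (i : Fin q) :
    y i ∈ Set.Icc (2 * Real.log (c / 2) + 2 - (C - q * (1 + Real.log c) + (1 + Real.log c)))
      (C - q * (1 + Real.log c) + (1 + Real.log c)) := by
  set b := 1 + Real.log c with hb
  have h1 : ∀ j, 0 ≤ Real.exp (- y j) * m j + y j - b := by
    intro j
    have e1 := Real.add_one_le_exp (- y j + Real.log c)
    rw [Real.exp_add, Real.exp_log hc] at e1
    have e2 := mul_le_mul_of_nonneg_left (hm j) (Real.exp_pos (- y j)).le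
    linarith
  have h2 := Finset.single_le_sum (f := fun j => Real.exp (- y j) * m j + y j - b)
    (fun j _ => h1 j) (Finset.mem_univ i)
  rw [Finset.sum_sub_distrib, Finset.sum_add_distrib] at h2
  simp at h2
  have e2 := mul_le_mul_of_nonneg_left (hm i) (Real.exp_pos (- y i)).le
  have e3 := mul_pos (Real.exp_pos (- y i)) hc
  have e1 := Real.add_one_le_exp (- y i + Real.log (c/2))
  rw [Real.exp_add, Real.exp_log (by positivity)] at e1
  constructor <;> linarith

theorem conj_tendsto {q : ℕ} {u v : ℕ → Matrix (Fin q) (Fin q) ℝ}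
    {V T : Matrix (Fin q) (Fin q) ℝ} (hu : Filter.Tendsto u Filter.atTop (nhds V))
    (hv : Filter.Tendsto v Filter.atTop (nhds T)) :
    Filter.Tendsto (fun n => (u n)ᵀ * v n * u n) Filter.atTop (nhds (Vᵀ * T * V)) := by
  have ht : Filter.Tendsto (fun n => (u n)ᵀ) Filter.atTop (nhds Vᵀ) :=
    ((continuous_id.matrix_transpose).tendsto V).comp hu
  exact (ht.mul hv).mul hu

theorem obj_tendsto {q : ℕ} {π : (Fin q → ℝ) → ℝ} (hπ : Continuous π) {y : ℕ → Fin q → ℝ}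
    {m : ℕ → Matrix (Fin q) (Fin q) ℝ} {t : ℕ → ℝ} {z : Fin q → ℝ}
    {M : Matrix (Fin q) (Fin q) ℝ} {t0 : ℝ}
    (hy : Filter.Tendsto y Filter.atTop (nhds z))
    (hm : Filter.Tendsto m Filter.atTop (nhds M))
    (ht : Filter.Tendsto t Filter.atTop (nhds t0)) :
    Filter.Tendsto (fun n => ∑ i, Real.exp (- y n i) * m n i i + ∑ i, y n i + t n * π (y n))
      Filter.atTop (nhds (∑ i, Real.exp (- z i) * M i i + ∑ i, z i + t0 * π z)) := by
  have hyi : ∀ i, Filter.Tendsto (fun n => y n i) Filter.atTop (nhds (z i)) :=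
    fun i => tendsto_pi_nhds.1 hy i
  have hmi : ∀ i, Filter.Tendsto (fun n => m n i i) Filter.atTop (nhds (M i i)) :=
    fun i => ((continuous_apply_apply i i).tendsto M).comp hm
  refine Filter.Tendsto.add (Filter.Tendsto.add ?_ ?_) ?_
  · refine tendsto_finsetSum _ fun i _ => ?_
    exact ((Real.continuous_exp.tendsto _).comp (hyi i).neg).mul (hmi i)
  · exact tendsto_finsetSum _ fun i _ => hyi i
  · exact ht.mul ((hπ.tendsto z).comp hy)

set_option maxHeartbeats 1000000 in
/-- consistency of the penalized estimator.  If `S_n → Σ_o`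
(positive definite), `η_n → η⁰ ≥ 0`, and `Σ̂_n` uniquely minimizes
`L(Σ; S_n, η_n)` while `Σ_{η⁰}` uniquely minimizes `L(Σ; Σ_o, η⁰)`, then
`Σ̂_n → Σ_{η⁰}`; in particular if `η⁰ = 0` then `Σ̂_n → Σ_o`. -/
theorem stmt_15 (q : ℕ) (π : (Fin q → ℝ) → ℝ)
    (hπconv : ConvexOn ℝ Set.univ π)
    (hπperm : ∀ (σ : Equiv.Perm (Fin q)) (y : Fin q → ℝ), π (y ∘ σ) = π y)
    (Pen : Matrix (Fin q) (Fin q) ℝ → ℝ)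
    (hPennn : ∀ A : Matrix (Fin q) (Fin q) ℝ, A.PosDef → 0 ≤ Pen A)
    (hPen : ∀ (A : Matrix (Fin q) (Fin q) ℝ) (hA : A.PosDef),
      Pen A = π fun i => Real.log (eigsDesc A hA.isHermitian i))
    (Sigstar : Matrix (Fin q) (Fin q) ℝ) (hSigstar : Sigstar.PosDef)
    (hSigstar0 : Pen Sigstar = 0)
    (S : ℕ → Matrix (Fin q) (Fin q) ℝ) (hSpd : ∀ n, (S n).PosDef)
    (Sigo : Matrix (Fin q) (Fin q) ℝ) (hSigo : Sigo.PosDef)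
    (hSconv : Filter.Tendsto S Filter.atTop (nhds Sigo))
    (η : ℕ → ℝ) (hηnn : ∀ n, 0 ≤ η n)
    (η0 : ℝ) (hη0 : 0 ≤ η0)
    (hηconv : Filter.Tendsto η Filter.atTop (nhds η0))
    (Sighat : ℕ → Matrix (Fin q) (Fin q) ℝ)
    (hSighat : ∀ n, (Sighat n).PosDef ∧
      ∀ A : Matrix (Fin q) (Fin q) ℝ, A.PosDef →
        (((Sighat n)⁻¹ * S n).trace + Real.log (Sighat n).det + η n * Pen (Sighat n) ≤
          (A⁻¹ * S n).trace + Real.log A.det + η n * Pen A) ∧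
        ((A⁻¹ * S n).trace + Real.log A.det + η n * Pen A =
          ((Sighat n)⁻¹ * S n).trace + Real.log (Sighat n).det + η n * Pen (Sighat n) →
          A = Sighat n))
    (Siglim : Matrix (Fin q) (Fin q) ℝ)
    (hSiglim : Siglim.PosDef ∧
      ∀ A : Matrix (Fin q) (Fin q) ℝ, A.PosDef →
        ((Siglim⁻¹ * Sigo).trace + Real.log Siglim.det + η0 * Pen Siglim ≤
          (A⁻¹ * Sigo).trace + Real.log A.det + η0 * Pen A) ∧
        ((A⁻¹ * Sigo).trace + Real.log A.det + η0 * Pen A =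
          (Siglim⁻¹ * Sigo).trace + Real.log Siglim.det + η0 * Pen Siglim →
          A = Siglim)) :
    Filter.Tendsto Sighat Filter.atTop (nhds Siglim) ∧
    (η0 = 0 → Filter.Tendsto Sighat Filter.atTop (nhds Sigo)) := by
  classical
  have hπc : Continuous π := by
    have := hπconv.continuousOn isOpen_univ
    exact continuousOn_univ.1 this
  have main : Filter.Tendsto Sighat Filter.atTop (nhds Siglim) := by
    choose U y hU hUy using fun n => exists_cj (Sighat n) (hSighat n).1
    have : FirstCountableTopology (Matrix (Fin q) (Fin q) ℝ) :=
      inferInstanceAs (FirstCountableTopology (Fin q → Fin q → ℝ))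
    apply Filter.tendsto_of_subseq_tendsto
    intro ns hns
    obtain ⟨V, hV, φ, hφ, hUlim⟩ := (ortho_compact q).tendsto_subseq (fun n => hU (ns n))
    have hns1 : Filter.Tendsto (fun n => ns (φ n)) Filter.atTop Filter.atTop :=
      hns.comp hφ.tendsto_atTop
    have hS1 : Filter.Tendsto (fun n => S (ns (φ n))) Filter.atTop (nhds Sigo) :=
      hSconv.comp hns1
    have hUlim' : Filter.Tendsto (fun n => U (ns (φ n))) Filter.atTop (nhds V) := hUlim
    have hVpd : (Vᵀ * Sigo * V).PosDef := by
      have := (Matrix.IsUnit.posDef_star_left_conjugate_iff (x := Sigo) (U := V)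
        (IsUnit.of_mul_eq_one_right _ hV)).2 hSigo
      simpa [star_eq_conjTranspose] using this
    have hmlim : Filter.Tendsto (fun n => (U (ns (φ n)))ᵀ * S (ns (φ n)) * U (ns (φ n)))
        Filter.atTop (nhds (Vᵀ * Sigo * V)) := by
      exact conj_tendsto hUlim' hS1
    obtain ⟨c, hc, hcV⟩ : ∃ c : ℝ, 0 < c ∧ ∀ i, c < (Vᵀ * Sigo * V) i i := by
      have hp : ∀ i, 0 < (Vᵀ * Sigo * V) i i := fun i => hVpd.diag_pos
      rcases isEmpty_or_nonempty (Fin q) with he | he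
      · exact ⟨1, one_pos, fun i => he.elim i⟩
      · obtain ⟨i0, hi0⟩ := Finite.exists_min (fun i => (Vᵀ * Sigo * V) i i)
        exact ⟨(Vᵀ * Sigo * V) i0 i0 / 2, half_pos (hp i0), fun i => by
          have := hi0 i; have := hp i0; linarith⟩
    have hcev : ∀ᶠ n in Filter.atTop, ∀ i,
        c ≤ ((U (ns (φ n)))ᵀ * S (ns (φ n)) * U (ns (φ n))) i i := by
      rw [Filter.eventually_all]
      intro i
      have h1 := ((continuous_apply_apply i i).tendsto (Vᵀ * Sigo * V)).comp hmlim
      exact (h1.eventually (lt_mem_nhds (hcV i))).mono fun n hn => le_of_lt hn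
    have htrlim : ∀ B : Matrix (Fin q) (Fin q) ℝ,
        Filter.Tendsto (fun n => (B * S (ns (φ n))).trace) Filter.atTop
          (nhds (B * Sigo).trace) := by
      intro B
      have hg : Continuous (fun p : Matrix (Fin q) (Fin q) ℝ => (B * p).trace) := by fun_prop
      exact (hg.tendsto Sigo).comp hS1
    let C := (Sigstar⁻¹ * Sigo).trace + 1 + Real.log Sigstar.det
    have hLval : ∀ n, ((Sighat n)⁻¹ * S n).trace + Real.log (Sighat n).det
        + η n * Pen (Sighat n) =
        ∑ i, Real.exp (- y n i) * ((U n)ᵀ * S n * U n) i i + ∑ i, y n i + η n * π (y n) := by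
      intro n
      rw [hUy n, cj_trace _ _ (hU n), cj_logdet _ _ (hU n), cj_pen π hπperm Pen hPen _ _ (hU n)]
    have hπnn : ∀ n, 0 ≤ π (y n) := by
      intro n
      rw [← cj_pen π hπperm Pen hPen _ _ (hU n)]
      exact hPennn _ (cj_posDef _ _ (hU n))
    have hCev : ∀ᶠ n in Filter.atTop,
        ∑ i, Real.exp (- y (ns (φ n)) i) * ((U (ns (φ n)))ᵀ * S (ns (φ n)) * U (ns (φ n))) i i
          + ∑ i, y (ns (φ n)) i ≤ C := by
      have h1 := (htrlim Sigstar⁻¹).eventually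
        (gt_mem_nhds (lt_add_one (Sigstar⁻¹ * Sigo).trace))
      filter_upwards [h1] with n hn
      have h2 := ((hSighat (ns (φ n))).2 Sigstar hSigstar).1
      rw [hLval, hSigstar0] at h2
      have h3 := mul_nonneg (hηnn (ns (φ n))) (hπnn (ns (φ n)))
      simp only [C]
      linarith
    let lo := 2 * Real.log (c / 2) + 2 - (C - q * (1 + Real.log c) + (1 + Real.log c))
    let hi := C - q * (1 + Real.log c) + (1 + Real.log c)
    have hKc : IsCompact (Set.univ.pi fun _ : Fin q => Set.Icc lo hi) :=
      isCompact_univ_pi fun _ => isCompact_Icc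
    have hyev : ∀ᶠ n in Filter.atTop,
        y (ns (φ n)) ∈ (Set.univ.pi fun _ : Fin q => Set.Icc lo hi) := by
      filter_upwards [hcev, hCev] with n h1 h2
      intro i _
      exact y_bound c C hc (y (ns (φ n))) _ h1 h2 i
    obtain ⟨z, -, ψ, hψ, hzlim⟩ := hKc.tendsto_subseq' hyev.frequently
    refine ⟨fun n => φ (ψ n), ?_⟩
    have hψt := hψ.tendsto_atTop
    have hUlim2 : Filter.Tendsto (fun n => U (ns (φ (ψ n)))) Filter.atTop (nhds V) :=
      hUlim.comp hψt
    have hzlim2 : Filter.Tendsto (fun n => y (ns (φ (ψ n)))) Filter.atTop (nhds z) := hzlim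
    have hA : Filter.Tendsto (fun n => Sighat (ns (φ (ψ n)))) Filter.atTop (nhds (cj V z)) := by
      have hg : Continuous (fun p : Matrix (Fin q) (Fin q) ℝ × (Fin q → ℝ) => cj p.1 p.2) := by
        unfold cj; fun_prop
      have := (hg.tendsto (V, z)).comp (hUlim2.prodMk_nhds hzlim2)
      refine this.congr fun n => ?_
      exact (hUy _).symm
    have hη2 : Filter.Tendsto (fun n => η (ns (φ (ψ n)))) Filter.atTop (nhds η0) :=
      hηconv.comp (hns1.comp hψt)
    have hm2 : Filter.Tendsto (fun n => (U (ns (φ (ψ n))))ᵀ * S (ns (φ (ψ n))) *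
        U (ns (φ (ψ n)))) Filter.atTop (nhds (Vᵀ * Sigo * V)) := hmlim.comp hψt
    have hLlim : Filter.Tendsto (fun n =>
        ∑ i, Real.exp (- y (ns (φ (ψ n))) i) *
          ((U (ns (φ (ψ n))))ᵀ * S (ns (φ (ψ n))) * U (ns (φ (ψ n)))) i i
          + ∑ i, y (ns (φ (ψ n))) i + η (ns (φ (ψ n))) * π (y (ns (φ (ψ n)))))
        Filter.atTop (nhds (∑ i, Real.exp (- z i) * (Vᵀ * Sigo * V) i i + ∑ i, z i
          + η0 * π z)) := by
      exact obj_tendsto hπc hzlim2 hm2 hη2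
    have hRlim : Filter.Tendsto (fun n => (Siglim⁻¹ * S (ns (φ (ψ n)))).trace
        + Real.log Siglim.det + η (ns (φ (ψ n))) * Pen Siglim) Filter.atTop
        (nhds ((Siglim⁻¹ * Sigo).trace + Real.log Siglim.det + η0 * Pen Siglim)) :=
      (((htrlim Siglim⁻¹).comp hψt).add_const _).add (hη2.mul_const _)
    have hle := le_of_tendsto_of_tendsto' hLlim hRlim fun n => by
      rw [← hLval]
      exact ((hSighat _).2 Siglim hSiglim.1).1
    rw [← cj_trace V z hV, ← cj_logdet V z hV, ← cj_pen π hπperm Pen hPen V z hV] at hle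
    have h3 := hSiglim.2 (cj V z) (cj_posDef V z hV)
    rw [← h3.2 (le_antisymm hle h3.1)]
    exact hA
  refine ⟨main, fun h0 => ?_⟩
  have h3 := hSiglim.2 Sigo hSigo
  have h4 := gauss_ineq Siglim Sigo hSiglim.1 hSigo
  have h5 : (Sigo⁻¹ * Sigo).trace = q := by
    rw [Matrix.nonsing_inv_mul _ hSigo.det_pos.ne'.isUnit]; simp
  rw [h0, h5] at h3
  simp only [zero_mul, add_zero] at h3
  rw [h3.2 (le_antisymm h4 h3.1)]
  exact main
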